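/- arXiv:2404.09874 — 2 statements merged into one kernel-verified Lean document; each statement's English description precedes it below -/
import Mathlib

section
/- Let $M$ be a field of characteristic $0$, let $s, u$ be indeterminates, and set $f(s,u,x) = x^5 + s x^3 + u(x+1) \in M(s,u)[x]$. Then the discriminant of $f$ with respect to $x$ equals $(108 s^5 + 16 s^4 u - 900 s^3 u - 128 s^2 u^2 + 2000 s u^2 + 3125 u^2 + 256 u^3)\, u^2$. -/
open Polynomial

noncomputable section

/-- The rational function field `M(s,u)` in two variables. -/
abbrev RatField (M : Type*) [Field M] : Type _ := FractionRing (MvPolynomial (Fin 2) M)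

/-- The element `s` of `M(s,u)`. -/
def sElt (M : Type*) [Field M] : RatField M :=
  algebraMap (MvPolynomial (Fin 2) M) (RatField M) (MvPolynomial.X 0)

/-- The element `u` of `M(s,u)`. -/
def uElt (M : Type*) [Field M] : RatField M :=
  algebraMap (MvPolynomial (Fin 2) M) (RatField M) (MvPolynomial.X 1)

/-- The quintic `f(s,u,x) = x⁵ + s x³ + u (x + 1) ∈ M(s,u)[x]`. -/
def quintic (M : Type*) [Field M] : Polynomial (RatField M) :=
  X ^ 5 + C (sElt M) * X ^ 3 + C (uElt M) * (X + 1)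

/-- The squared Vandermonde determinant is the determinant of the Hankel matrix of power sums. -/
theorem prod_sub_sq_eq_det_hankel {R : Type*} [CommRing R] {n : ℕ} (r : Fin n → R) :
    (∏ i : Fin n, ∏ j ∈ Finset.univ.filter (fun j => i < j), (r i - r j) ^ 2) =
      (Matrix.of fun i j : Fin n => ∑ k, r k ^ ((i : ℕ) + j)).det := by
  have hankel : (Matrix.of fun i j : Fin n => ∑ k, r k ^ ((i : ℕ) + j)) =
      (Matrix.vandermonde r).transpose * Matrix.vandermonde r := by
    ext i j
    simp [Matrix.mul_apply, Matrix.vandermonde_apply, pow_add]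
  rw [hankel, Matrix.det_mul, Matrix.det_transpose, Matrix.det_vandermonde, ← sq,
    ← Finset.prod_pow]
  refine Finset.prod_congr rfl fun i _ => ?_
  rw [← Finset.prod_pow]
  refine Finset.prod_congr (by ext j; simp) fun j _ => by ring

/-- The coefficients of a monic quintic in terms of its roots. -/
theorem prod_X_sub_C_fin_five {R : Type*} [CommRing R] (r : Fin 5 → R) :
    (∏ i : Fin 5, (X - C (r i))) =
      X ^ 5 + C (-(r 0 + r 1 + r 2 + r 3 + r 4)) * X ^ 4
        + C (r 0 * r 1 + r 0 * r 2 + r 0 * r 3 + r 0 * r 4 + r 1 * r 2 + r 1 * r 3 + r 1 * r 4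
          + r 2 * r 3 + r 2 * r 4 + r 3 * r 4) * X ^ 3
        + C (-(r 0 * r 1 * r 2 + r 0 * r 1 * r 3 + r 0 * r 1 * r 4 + r 0 * r 2 * r 3
          + r 0 * r 2 * r 4 + r 0 * r 3 * r 4 + r 1 * r 2 * r 3 + r 1 * r 2 * r 4
          + r 1 * r 3 * r 4 + r 2 * r 3 * r 4)) * X ^ 2
        + C (r 0 * r 1 * r 2 * r 3 + r 0 * r 1 * r 2 * r 4 + r 0 * r 1 * r 3 * r 4
          + r 0 * r 2 * r 3 * r 4 + r 1 * r 2 * r 3 * r 4) * X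
        + C (-(r 0 * r 1 * r 2 * r 3 * r 4)) := by
  simp only [Fin.prod_univ_five, map_add, map_mul, map_neg]
  ring

/-- The discriminant of `x⁵ + s x³ + u (x + 1)`, as a product over its roots. -/
theorem prod_sub_sq_of_quintic_eq_prod {R : Type*} [CommRing R] (s u : R) (r : Fin 5 → R)
    (hr : X ^ 5 + C s * X ^ 3 + C u * (X + 1) = ∏ i : Fin 5, (X - C (r i))) :
    (∏ i : Fin 5, ∏ j ∈ Finset.univ.filter (fun j => i < j), (r i - r j) ^ 2) =
      (108 * s ^ 5 + 16 * s ^ 4 * u - 900 * s ^ 3 * u - 128 * s ^ 2 * u ^ 2 + 2000 * s * u ^ 2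
        + 3125 * u ^ 2 + 256 * u ^ 3) * u ^ 2 := by
  have root (i : Fin 5) : r i ^ 5 = -s * r i ^ 3 - u * r i - u := by
    have h := congrArg (Polynomial.eval (r i)) hr
    rw [Polynomial.eval_prod, Finset.prod_eq_zero (Finset.mem_univ i) (by simp)] at h
    simp only [eval_add, eval_mul, eval_pow, eval_X, eval_C, eval_one] at h
    linear_combination h
  rw [prod_X_sub_C_fin_five] at hr
  have e₁ := congrArg (fun p => p.coeff 4) hr
  have e₂ := congrArg (fun p => p.coeff 3) hr
  have e₃ := congrArg (fun p => p.coeff 2) hr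
  have e₄ := congrArg (fun p => p.coeff 1) hr
  simp [coeff_C, coeff_X_pow, mul_add, -neg_add_rev, -map_add, -map_mul,
    -map_neg] at e₁ e₂ e₃ e₄
  have p₁ : ∑ k, r k ^ 1 = 0 := by
    rw [Fin.sum_univ_five]; linear_combination e₁
  have p₂ : ∑ k, r k ^ 2 = -2 * s := by
    rw [Fin.sum_univ_five]
    linear_combination (r 0 + r 1 + r 2 + r 3 + r 4) * e₁ + 2 * e₂
  have recurrence (m : ℕ) : ∑ k, r k ^ (m + 5) =
      -s * ∑ k, r k ^ (m + 3) - u * ∑ k, r k ^ (m + 1) - u * ∑ k, r k ^ m := by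
    simp only [Finset.mul_sum, ← Finset.sum_sub_distrib]
    refine Finset.sum_congr rfl fun k _ => ?_
    rw [pow_add, root]
    ring
  have p₃ : ∑ k, r k ^ 3 = 0 := by
    rw [Fin.sum_univ_five]
    linear_combination (r 0 ^ 2 + r 1 ^ 2 + r 2 ^ 2 + r 3 ^ 2 + r 4 ^ 2 - s) * e₁
      + (r 0 + r 1 + r 2 + r 3 + r 4) * e₂ + 3 * e₃
  have p₄ : ∑ k, r k ^ 4 = 2 * s ^ 2 - 4 * u := by
    rw [Fin.sum_univ_five] at p₂ ⊢
    linear_combination (r 0 ^ 3 + r 1 ^ 3 + r 2 ^ 3 + r 3 ^ 3 + r 4 ^ 3) * e₁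
      + (r 0 ^ 2 + r 1 ^ 2 + r 2 ^ 2 + r 3 ^ 2 + r 4 ^ 2) * e₂ - s * p₂
      + (r 0 + r 1 + r 2 + r 3 + r 4) * e₃ + 4 * e₄
  have p₀ : ∑ k, r k ^ 0 = 5 := by simp
  have p₅ : ∑ k, r k ^ 5 = -5 * u := by
    linear_combination recurrence 0 - s * p₃ - u * p₁ - u * p₀
  have p₆ : ∑ k, r k ^ 6 = -2 * s ^ 3 + 6 * s * u := by
    linear_combination recurrence 1 - s * p₄ - u * p₂ - u * p₁
  have p₇ : ∑ k, r k ^ 7 = 7 * s * u := by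
    linear_combination recurrence 2 - s * p₅ - u * p₃ - u * p₂
  have p₈ : ∑ k, r k ^ 8 = 2 * s ^ 4 - 8 * s ^ 2 * u + 4 * u ^ 2 := by
    linear_combination recurrence 3 - s * p₆ - u * p₄ - u * p₃
  rw [prod_sub_sq_eq_det_hankel]
  have hankel : (Matrix.of fun i j : Fin 5 => ∑ k, r k ^ ((i : ℕ) + j)) =
      !![5, 0, -2 * s, 0, 2 * s ^ 2 - 4 * u;
        0, -2 * s, 0, 2 * s ^ 2 - 4 * u, -5 * u;
        -2 * s, 0, 2 * s ^ 2 - 4 * u, -5 * u, -2 * s ^ 3 + 6 * s * u;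
        0, 2 * s ^ 2 - 4 * u, -5 * u, -2 * s ^ 3 + 6 * s * u, 7 * s * u;
        2 * s ^ 2 - 4 * u, -5 * u, -2 * s ^ 3 + 6 * s * u, 7 * s * u,
          2 * s ^ 4 - 8 * s ^ 2 * u + 4 * u ^ 2] := by
    ext i j
    fin_cases i <;> fin_cases j
    all_goals first
      | exact p₀ | exact p₁ | exact p₂ | exact p₃ | exact p₄ | exact p₅ | exact p₆ | exact p₇
      | exact p₈
  rw [hankel]
  simp [Matrix.det_succ_row_zero, Fin.sum_univ_succ, Fin.succAbove]
  ring

/-- Over a field `M` of characteristic `0`, the discriminant of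
`f(s,u,x) = x⁵ + s x³ + u(x+1)` with respect to `x` equals
`(108 s⁵ + 16 s⁴ u - 900 s³ u - 128 s² u² + 2000 s u² + 3125 u² + 256 u³) u²`.
The discriminant of the monic quintic is expressed as `∏_{i<j} (rᵢ - rⱼ)²` over the roots
`r` in any field extension where `f` splits. -/
theorem statement12 (M : Type*) [Field M] [CharZero M]
    (L : Type*) [Field L] [Algebra (RatField M) L] (r : Fin 5 → L)
    (hr : (quintic M).map (algebraMap (RatField M) L) = ∏ i : Fin 5, (X - C (r i))) :
    (∏ i : Fin 5, ∏ j ∈ Finset.univ.filter (fun j => i < j), (r i - r j) ^ 2) =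
      algebraMap (RatField M) L
        ((108 * sElt M ^ 5 + 16 * sElt M ^ 4 * uElt M - 900 * sElt M ^ 3 * uElt M
            - 128 * sElt M ^ 2 * uElt M ^ 2 + 2000 * sElt M * uElt M ^ 2
            + 3125 * uElt M ^ 2 + 256 * uElt M ^ 3) * uElt M ^ 2) := by
  have h := prod_sub_sq_of_quintic_eq_prod (algebraMap (RatField M) L (sElt M))
    (algebraMap (RatField M) L (uElt M)) r (by rw [← hr]; simp [quintic])
  rw [h]
  simp only [map_mul, map_add, map_sub, map_pow, map_ofNat]

end
end

section
/- Let $M$ be a field of characteristic $0$, $\alpha \in M^\times$, and $f(s,u,x) = x^5 + sx^3 + u(x+1)$ with discriminant $D(s,u) = (108 s^5 + 16 s^4 u - 900 s^3 u - 128 s^2 u^2 + 2000 s u^2 + 3125 u^2 + 256 u^3) u^2$. Then the field $M(s, u, \sqrt{\alpha \cdot D(s,u)})$ is a purely transcendental extension of $M$ of transcendence degree $2$; explicitly, setting $w = u/s^2$, $v = u^2/s^5$, $P = 1000w^2 - 450w + 54$, $Q = (9-20w)(1-5w)$, $A = 25\sqrt{\alpha D}/(s^5 Q)$ and $B = (5^5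 v + P)/Q$, one has $M(s,u,\sqrt{\alpha D}) = M(A, B)$. -/
noncomputable section

/-- The discriminant `D(s,u)` of the quintic `x⁵ + s x³ + u(x+1)`. -/
def discElt (M : Type*) [Field M] : RatField M :=
  (108 * sElt M ^ 5 + 16 * sElt M ^ 4 * uElt M - 900 * sElt M ^ 3 * uElt M
      - 128 * sElt M ^ 2 * uElt M ^ 2 + 2000 * sElt M * uElt M ^ 2
      + 3125 * uElt M ^ 2 + 256 * uElt M ^ 3) * uElt M ^ 2

/-- `w = u/s²`. -/
def wElt (M : Type*) [Field M] : RatField M := uElt M / sElt M ^ 2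

/-- `v = u²/s⁵`. -/
def vElt (M : Type*) [Field M] : RatField M := uElt M ^ 2 / sElt M ^ 5

/-- `P = 1000 w² - 450 w + 54`. -/
def pElt (M : Type*) [Field M] : RatField M := 1000 * wElt M ^ 2 - 450 * wElt M + 54

/-- `Q = (9 - 20w)(1 - 5w)`. -/
def qElt (M : Type*) [Field M] : RatField M := (9 - 20 * wElt M) * (1 - 5 * wElt M)

open AlgebraicIndependent in
/-- A finite family generating a field that contains an algebraically independent family of the
same size is algebraically independent. -/
theorem AlgebraicIndependent.of_forall_mem_adjoin_range {K L ι : Type*} [Field K] [Field L]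
    [Algebra K L] [Finite ι] {x y : ι → L} (hy : AlgebraicIndependent K y)
    (hmem : ∀ i, y i ∈ IntermediateField.adjoin K (Set.range x)) :
    AlgebraicIndependent K x := by
  have hsub : Set.range y ⊆ (matroid K L).closure (Set.range x) := by
    rintro _ ⟨i, rfl⟩
    rw [matroid_closure_eq, SetLike.mem_coe, Subalgebra.mem_algebraicClosure]
    obtain ⟨a, ha, b, hb, hab⟩ := IntermediateField.mem_adjoin_iff_div.1 (hmem i)
    rw [hab, div_eq_mul_inv]
    exact (isAlgebraic_algebraMap (⟨a, ha⟩ : Algebra.adjoin K (Set.range x))).mul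
      (isAlgebraic_algebraMap (⟨b, hb⟩ : Algebra.adjoin K (Set.range x))).inv
  have hcard : (Set.range y).encard ≤ (matroid K L).eRk (Set.range x) := by
    have hind : (matroid K L).Indep (Set.range y) := matroid_indep_iff.2 hy.to_subtype_range
    rw [← hind.eRk_eq_encard, ← (matroid K L).eRk_closure_eq (Set.range x)]
    exact (matroid K L).eRk_mono hsub
  have hyc : (Set.range y).encard = ENat.card ι := by
    rw [← Set.image_univ, hy.injective.encard_image, Set.encard_univ]
  have hxc : (Set.range x).encard ≤ ENat.card ι := by
    rw [← Set.image_univ, ← Set.encard_univ]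
    exact Set.encard_image_le _ _
  have hcard' : ENat.card ι ≤ (Set.range x).encard :=
    hyc ▸ hcard.trans ((matroid K L).eRk_le_encard _)
  have hx : (matroid K L).Indep (Set.range x) :=
    (Matroid.indep_iff_eRk_eq_encard_of_finite (Set.finite_range x)).2
      (((matroid K L).eRk_le_encard _).antisymm (hxc.trans (hyc ▸ hcard)))
  have hinj : Function.Injective x := by
    rw [← Set.injOn_univ]
    refine Set.finite_univ.injOn_of_encard_image_eq ?_
    rw [Set.image_univ, Set.encard_univ]
    exact hxc.antisymm hcard'
  exact .of_subtype_range hinj (matroid_indep_iff.1 hx)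

theorem sElt_ne_zero (M : Type*) [Field M] : sElt M ≠ 0 := by
  simp [sElt]

theorem uElt_ne_zero (M : Type*) [Field M] : uElt M ≠ 0 := by
  simp [uElt]

theorem sub_mul_wElt_ne_zero {M : Type*} [Field M] {a : M} (ha : a ≠ 0) (b : M) :
    algebraMap M (RatField M) a - algebraMap M (RatField M) b * wElt M ≠ 0 := by
  intro h
  have hs := sElt_ne_zero M
  have h' : algebraMap M (RatField M) a * sElt M ^ 2
      - algebraMap M (RatField M) b * uElt M = 0 := by
    rw [wElt] at h
    field_simp at h
    linear_combination h
  have hpoly : (MvPolynomial.C a * MvPolynomial.X 0 ^ 2 - MvPolynomial.C b * MvPolynomial.X 1 :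
      MvPolynomial (Fin 2) M) = 0 := by
    apply IsFractionRing.injective (MvPolynomial (Fin 2) M) (RatField M)
    simpa [sElt, uElt, IsScalarTower.algebraMap_apply M (MvPolynomial (Fin 2) M) (RatField M),
      MvPolynomial.algebraMap_eq] using h'
  have heval := congrArg (MvPolynomial.eval ![1, 0]) hpoly
  simp [ha] at heval

theorem qElt_ne_zero (M : Type*) [Field M] [CharZero M] : qElt M ≠ 0 := by
  have h9 := sub_mul_wElt_ne_zero (M := M) (a := 9) (by norm_num) 20
  have h1 := sub_mul_wElt_ne_zero (M := M) (a := 1) one_ne_zero 5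
  simp only [map_ofNat, map_one] at h9 h1
  exact mul_ne_zero h9 h1

theorem algebraicIndependent_sElt_uElt (M : Type*) [Field M] :
    AlgebraicIndependent M ![sElt M, uElt M] := by
  have h := (MvPolynomial.algebraicIndependent_X (Fin 2) M).map'
    (f := IsScalarTower.toAlgHom M (MvPolynomial (Fin 2) M) (RatField M))
    (IsFractionRing.injective _ _)
  convert h using 1
  ext i
  fin_cases i <;> rfl

theorem discElt_eq (M : Type*) [Field M] :
    3125 * discElt M = sElt M ^ 10 *
      ((5 ^ 5 * vElt M + pElt M) ^ 2 - qElt M ^ 2 * (36 - 80 * wElt M)) := by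
  have hs := sElt_ne_zero M
  simp only [discElt, pElt, qElt, vElt, wElt]
  field_simp
  ring

/-- Over a field `M` of characteristic `0` and for `α ∈ M^×`, the field
`M(s, u, √(α·D(s,u)))` is purely transcendental of transcendence degree `2` over `M`:
explicitly, with `A = 25√(αD)/(s⁵Q)` and `B = (5⁵v + P)/Q`, one has
`M(s,u,√(αD)) = M(A,B)` with `A, B` algebraically independent over `M`. Here the quadratic
extension is realized inside any field `L` containing `M(s,u)` and a square root `sq` of
`α·D(s,u)`. -/
theorem statement14 (M : Type*) [Field M] [CharZero M] (α : M) (hα : α ≠ 0)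
    (L : Type*) [Field L] [Algebra (RatField M) L] [Algebra M L]
    [IsScalarTower M (RatField M) L]
    (sq : L)
    (hsq : sq ^ 2 = algebraMap (RatField M) L
      (algebraMap (MvPolynomial (Fin 2) M) (RatField M) (MvPolynomial.C α) * discElt M)) :
    IntermediateField.adjoin M
        ({algebraMap (RatField M) L (sElt M), algebraMap (RatField M) L (uElt M), sq} :
          Set L) =
      IntermediateField.adjoin M
        ({(25 : L) * sq / algebraMap (RatField M) L (sElt M ^ 5 * qElt M),
          algebraMap (RatField M) L (((5 : RatField M) ^ 5 * vElt M + pElt M) / qElt M)} :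
          Set L) ∧
    AlgebraicIndependent M
      ![(25 : L) * sq / algebraMap (RatField M) L (sElt M ^ 5 * qElt M),
        algebraMap (RatField M) L (((5 : RatField M) ^ 5 * vElt M + pElt M) / qElt M)] := by
  set φ := algebraMap (RatField M) L with hφ
  have : CharZero L := charZero_of_injective_algebraMap φ.injective
  set a := algebraMap M L α with ha_def
  have ha : a ≠ 0 := by simpa [a] using hα
  have haC : φ (algebraMap (MvPolynomial (Fin 2) M) (RatField M) (MvPolynomial.C α)) = a := by
    rw [← MvPolynomial.algebraMap_eq, ← IsScalarTower.algebraMap_apply M _ (RatField M), hφ,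
      ← IsScalarTower.algebraMap_apply M (RatField M) L]
  have hφn (n : ℕ) [n.AtLeastTwo] : φ (OfNat.ofNat n) = OfNat.ofNat n := map_ofNat φ n
  have hs : φ (sElt M) ≠ 0 := by simpa using sElt_ne_zero M
  have hu : φ (uElt M) ≠ 0 := by simpa using uElt_ne_zero M
  have hq : φ (qElt M) ≠ 0 := by simpa using qElt_ne_zero M
  have hw : φ (wElt M) = φ (uElt M) / φ (sElt M) ^ 2 := by simp [wElt]
  have hv : φ (vElt M) = φ (uElt M) ^ 2 / φ (sElt M) ^ 5 := by simp [vElt]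
  have hP : φ (pElt M) = 1000 * φ (wElt M) ^ 2 - 450 * φ (wElt M) + 54 := by simp [pElt, hφn]
  have hQ : φ (qElt M) = (9 - 20 * φ (wElt M)) * (1 - 5 * φ (wElt M)) := by simp [qElt, hφn]
  have hD : 3125 * φ (discElt M) = φ (sElt M) ^ 10 * ((5 ^ 5 * φ (vElt M) + φ (pElt M)) ^ 2
      - φ (qElt M) ^ 2 * (36 - 80 * φ (wElt M))) := by
    simpa [hφn] using congrArg φ (discElt_eq M)
  rw [map_mul, haC] at hsq
  set A := (25 : L) * sq / φ (sElt M ^ 5 * qElt M) with hA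
  set B := φ (((5 : RatField M) ^ 5 * vElt M + pElt M) / qElt M) with hB
  have hA' : A = 25 * sq / (φ (sElt M) ^ 5 * φ (qElt M)) := by simp [hA]
  have hB' : B = (5 ^ 5 * φ (vElt M) + φ (pElt M)) / φ (qElt M) := by simp [hB, hφn]
  have hAB : φ (wElt M) = (5 * A ^ 2 / a - B ^ 2 + 36) / 80 := by
    rw [hA', hB']
    field_simp
    rw [hsq]
    linear_combination (-a) * hD
  have hvB : φ (vElt M) = (B * φ (qElt M) - φ (pElt M)) / 3125 := by
    rw [hB']
    field_simp
    ring
  have hsv : φ (sElt M) = φ (wElt M) ^ 2 / φ (vElt M) := by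
    rw [hw, hv]
    field_simp
  have huw : φ (uElt M) = φ (wElt M) * φ (sElt M) ^ 2 := by
    rw [hw]
    field_simp
  have hsqA : sq = A * φ (sElt M) ^ 5 * φ (qElt M) / 25 := by
    rw [hA']
    field_simp
  have hn (F : IntermediateField M L) (n : ℕ) [n.AtLeastTwo] : (OfNat.ofNat n : L) ∈ F :=
    ofNat_mem F n
  have mem_pq (F : IntermediateField M L) (h : φ (wElt M) ∈ F) :
      φ (pElt M) ∈ F ∧ φ (qElt M) ∈ F := by
    rw [hP, hQ]
    exact ⟨add_mem (sub_mem (mul_mem (hn F _) (pow_mem h 2)) (mul_mem (hn F _) h)) (hn F _),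
      mul_mem (sub_mem (hn F _) (mul_mem (hn F _) h))
        (sub_mem (one_mem F) (mul_mem (hn F _) h))⟩
  have mem_su : φ (sElt M) ∈ IntermediateField.adjoin M {A, B} ∧
      φ (uElt M) ∈ IntermediateField.adjoin M {A, B} ∧
      sq ∈ IntermediateField.adjoin M {A, B} := by
    set F := IntermediateField.adjoin M {A, B}
    have hAF : A ∈ F := IntermediateField.subset_adjoin _ _ (by simp)
    have hBF : B ∈ F := IntermediateField.subset_adjoin _ _ (by simp)
    have hwF : φ (wElt M) ∈ F := by
      rw [hAB]
      exact div_mem (add_mem (sub_mem (div_mem (mul_mem (hn F _) (pow_mem hAF 2))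
        (F.algebraMap_mem α)) (pow_mem hBF 2)) (hn F _)) (hn F _)
    obtain ⟨hpF, hqF⟩ := mem_pq F hwF
    have hvF : φ (vElt M) ∈ F := by
      rw [hvB]
      exact div_mem (sub_mem (mul_mem hBF hqF) hpF) (hn F _)
    have hsF : φ (sElt M) ∈ F := by
      rw [hsv]
      exact div_mem (pow_mem hwF 2) hvF
    refine ⟨hsF, ?_, ?_⟩
    · rw [huw]
      exact mul_mem hwF (pow_mem hsF 2)
    · rw [hsqA]
      exact div_mem (mul_mem (mul_mem hAF (pow_mem hsF 5)) hqF) (hn F _)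
  refine ⟨le_antisymm ?_ ?_, ?_⟩
  · rw [IntermediateField.adjoin_le_iff]
    rintro x (rfl | rfl | rfl)
    exacts [mem_su.1, mem_su.2.1, mem_su.2.2]
  · set F := IntermediateField.adjoin M {φ (sElt M), φ (uElt M), sq}
    have hsF : φ (sElt M) ∈ F := IntermediateField.subset_adjoin _ _ (by simp)
    have huF : φ (uElt M) ∈ F := IntermediateField.subset_adjoin _ _ (by simp)
    have hsqF : sq ∈ F := IntermediateField.subset_adjoin _ _ (by simp)
    have hwF : φ (wElt M) ∈ F := hw ▸ div_mem huF (pow_mem hsF 2)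
    have hvF : φ (vElt M) ∈ F := hv ▸ div_mem (pow_mem huF 2) (pow_mem hsF 5)
    obtain ⟨hpF, hqF⟩ := mem_pq F hwF
    rw [IntermediateField.adjoin_le_iff]
    rintro x (rfl | rfl)
    · rw [SetLike.mem_coe, hA']
      exact div_mem (mul_mem (hn F _) hsqF) (mul_mem (pow_mem hsF 5) hqF)
    · rw [SetLike.mem_coe, hB']
      exact div_mem (add_mem (mul_mem (pow_mem (hn F _) 5) hvF) hpF) hqF
  · refine AlgebraicIndependent.of_forall_mem_adjoin_range
      ((algebraicIndependent_sElt_uElt M).map' (f := IsScalarTower.toAlgHom M (RatField M) L)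
        φ.injective) ?_
    rw [Matrix.range_cons_cons_empty]
    intro i
    fin_cases i
    exacts [mem_su.1, mem_su.2.1]

end
end
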